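/- Let U ⊂ G be open, f ∈ C¹_G(U, ℝᵏ), and let P ∈ U with f(P) = 0 and the k×k matrix M₁(P) := (X_i f_j(P))_{j,i=1,…,k} invertible. Then there exist an open set 𝒪 ⊂ ℝ^{m−k} × ℝ^n, a map φ : 𝒪 → ℝᵏ which is uniformly intrinsically differentiable at every point of 𝒪, and an open set U' ⊂ U with P ∈ U', such that {Q ∈ U' : f(Q) = 0} = graph(φ) ∩ U'. -/

import Mathlib

noncomputable section

open Set Filter Topology MeasureTheory

namespace Carnot

/-- Euclidean norm on `Fin d → ℝ`. -/
def enorm {d : ℕ} (x : Fin d → ℝ) : ℝ := Real.sqrt (∑ i, (x i) ^ 2)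

/-- The underlying set of the Carnot group `G = ℝ^m × ℝ^n` of class `𝓑`. -/
abbrev G (m n : ℕ) := (Fin m → ℝ) × (Fin n → ℝ)

/-- Points of the normal complement `W`, identified with `ℝ^(m-k) × ℝ^n`. -/
abbrev W (m n k : ℕ) := (Fin (m - k) → ℝ) × (Fin n → ℝ)

/-- The group law of the Carnot group of class `𝓑` associated with the
skew-symmetric matrices `b s`:
`(x,y)·(x',y') = (x + x', y + y' + ½⟨Bx,x'⟩)`. -/
def gmul {m n : ℕ} (b : Fin n → Matrix (Fin m) (Fin m) ℝ) (P Q : G m n) : G m n :=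
  (P.1 + Q.1, fun s => P.2 s + Q.2 s + (1 / 2) * ∑ i, ∑ j, b s i j * P.1 j * Q.1 i)

/-- The group inverse `(x,y)⁻¹ = (-x,-y)`. -/
def ginv {m n : ℕ} (P : G m n) : G m n := (-P.1, -P.2)

/-- The homogeneous quasi-norm `N(x,y) = |x| + |y|^(1/2)`. -/
def qnorm {m n : ℕ} (P : G m n) : ℝ := enorm P.1 + Real.sqrt (enorm P.2)

/-- Open ball for the quasi-norm: `U(P,r) = {Q : N(P⁻¹·Q) < r}`. -/
def ball (m n : ℕ) (b : Fin n → Matrix (Fin m) (Fin m) ℝ) (P : G m n) (r : ℝ) : Set (G m n) :=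
  {Q | qnorm (gmul b (ginv P) Q) < r}

/-- The embedding `i : ℝ^(m-k) × ℝ^n → G`, `i(a,α) = (0,…,0,a,α)`. -/
def embW (m n k : ℕ) (A : W m n k) : G m n :=
  (fun j => if h : (j : ℕ) < k then 0 else A.1 ⟨(j : ℕ) - k, by have := j.isLt; omega⟩, A.2)

/-- The embedding of `ℝ^k` as the horizontal subgroup `H`, `v ↦ (v,0,…,0)`. -/
def embH (m n k : ℕ) (v : Fin k → ℝ) : G m n :=
  (fun j => if h : (j : ℕ) < k then v ⟨(j : ℕ), h⟩ else 0, 0)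

/-- The graph map `Φ(A) = i(A)·φ̂(A)`. -/
def graphMap (m n k : ℕ) (b : Fin n → Matrix (Fin m) (Fin m) ℝ)
    (φ : W m n k → Fin k → ℝ) (A : W m n k) : G m n :=
  gmul b (embW m n k A) (embH m n k (φ A))

/-- `N(i(A)⁻¹·i(B))`. -/
def dW (m n k : ℕ) (b : Fin n → Matrix (Fin m) (Fin m) ℝ) (A B : W m n k) : ℝ :=
  qnorm (gmul b (ginv (embW m n k A)) (embW m n k B))

/-- The graph quasi-distance `σ_φ(A,B) = N(φ̂(A)⁻¹·i(A)⁻¹·i(B)·φ̂(A))`. -/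
def sigma (m n k : ℕ) (b : Fin n → Matrix (Fin m) (Fin m) ℝ)
    (φ : W m n k → Fin k → ℝ) (A B : W m n k) : ℝ :=
  qnorm (gmul b (gmul b (gmul b (ginv (embH m n k (φ A))) (ginv (embW m n k A)))
    (embW m n k B)) (embH m n k (φ A)))

/-- The matrix `M` satisfies the uniform intrinsic differentiability condition of `φ`
at `A₀ ∈ 𝒪`. -/
def UID (m n k : ℕ) (b : Fin n → Matrix (Fin m) (Fin m) ℝ) (O : Set (W m n k))
    (φ : W m n k → Fin k → ℝ) (A₀ : W m n k) (M : Matrix (Fin k) (Fin (m - k)) ℝ) : Prop :=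
  ∀ ε > 0, ∃ r > 0, ∀ A ∈ O, ∀ B ∈ O,
    dW m n k b A₀ A < r → dW m n k b A B < r → 0 < dW m n k b A B →
    enorm (fun j => φ B j - φ A j - ∑ i, M j i * (B.1 i - A.1 i)) ≤ ε * sigma m n k b φ A B

/-- `f : U → ℝ^k` is of class `C¹_G` with (continuous) horizontal Jacobian `gradf`. -/
def C1G (m n k : ℕ) (b : Fin n → Matrix (Fin m) (Fin m) ℝ) (U : Set (G m n))
    (f : G m n → Fin k → ℝ) (gradf : G m n → Matrix (Fin k) (Fin m) ℝ) : Prop :=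
  ContinuousOn f U ∧ ContinuousOn gradf U ∧
  ∀ P ∈ U, ∀ ε > 0, ∃ r > 0, ∀ Q ∈ U,
    qnorm (gmul b (ginv P) Q) < r →
    enorm (fun j => f Q j - f P j - ∑ i, gradf P j i * (Q.1 i - P.1 i)) ≤
      ε * qnorm (gmul b (ginv P) Q)

/-- The square block `M₁(Q) = (X_i f_j(Q))_{j,i=1,…,k}` of the horizontal Jacobian. -/
def M1 (m n k : ℕ) (hk : k ≤ m) (gradf : G m n → Matrix (Fin k) (Fin m) ℝ) (Q : G m n) :
    Matrix (Fin k) (Fin k) ℝ :=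
  Matrix.of fun j i => gradf Q j (Fin.castLE hk i)

/-- The block `M₂(Q) = (X_{k+i} f_j(Q))_{j=1,…,k; i=1,…,m-k}` of the horizontal Jacobian. -/
def M2 (m n k : ℕ) (gradf : G m n → Matrix (Fin k) (Fin m) ℝ) (Q : G m n) :
    Matrix (Fin k) (Fin (m - k)) ℝ :=
  Matrix.of fun j i => gradf Q j ⟨k + (i : ℕ), by have := i.isLt; omega⟩

/-- The bracket `(x, x') ↦ ⟨Bx, x'⟩` as a continuous bilinear map. -/
def bracket {m n : ℕ} (b : Fin n → Matrix (Fin m) (Fin m) ℝ) :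
    (Fin m → ℝ) →L[ℝ] (Fin m → ℝ) →L[ℝ] (Fin n → ℝ) :=
  (LinearMap.mk₂ ℝ (fun (x x' : Fin m → ℝ) s => x' ⬝ᵥ (b s).mulVec x)
    (fun x y z => by ext s; simp [Matrix.mulVec_add])
    (fun c x z => by ext s; simp [Matrix.mulVec_smul])
    (fun x y z => by ext s; simp)
    (fun c x z => by ext s; simp)).toContinuousBilinearMap

/-- The horizontal Jacobian as a continuous linear map. -/
def jac {m k : ℕ} : Matrix (Fin k) (Fin m) ℝ →L[ℝ] (Fin m → ℝ) →L[ℝ] (Fin k → ℝ) :=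
  (Matrix.mulVecBilin ℝ ℝ).toContinuousBilinearMap

section Algebra

variable {m n : ℕ} {b : Fin n → Matrix (Fin m) (Fin m) ℝ}

lemma bracket_apply (x x' : Fin m → ℝ) (s : Fin n) :
    bracket b x x' s = x' ⬝ᵥ (b s).mulVec x := rfl

lemma jac_apply {k : ℕ} (A : Matrix (Fin k) (Fin m) ℝ) (x : Fin m → ℝ) :
    jac A x = A.mulVec x := rfl

lemma gmul_eq (P Q : G m n) :
    gmul b P Q = (P.1 + Q.1, P.2 + Q.2 + (1 / 2 : ℝ) • bracket b P.1 Q.1) := by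
  refine Prod.ext rfl ?_
  ext s
  simp only [gmul, Pi.add_apply, Pi.smul_apply, bracket_apply, dotProduct, Matrix.mulVec,
    smul_eq_mul, Finset.mul_sum]
  congr 1
  refine Finset.sum_congr rfl fun i _ => Finset.sum_congr rfl fun j _ => ?_
  ring

lemma bracket_swap (hskew : ∀ s, (b s).transpose = -(b s)) (x y : Fin m → ℝ) :
    bracket b x y = -bracket b y x := by
  ext s
  rw [Pi.neg_apply, bracket_apply, bracket_apply, ← Matrix.dotProduct_transpose_mulVec, hskew,
    Matrix.neg_mulVec]
  simp

lemma bracket_self (hskew : ∀ s, (b s).transpose = -(b s)) (x : Fin m → ℝ) :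
    bracket b x x = 0 :=
  self_eq_neg.mp (bracket_swap hskew x x)

lemma gmul_assoc (P Q R : G m n) : gmul b (gmul b P Q) R = gmul b P (gmul b Q R) := by
  simp only [gmul_eq, map_add, _root_.add_apply]
  ext <;> simp <;> ring

lemma gmul_zero (P : G m n) : gmul b P 0 = P := by
  simp [gmul_eq]

lemma ginv_gmul_cancel (hskew : ∀ s, (b s).transpose = -(b s)) (P Q : G m n) :
    gmul b (ginv P) (gmul b P Q) = Q := by
  ext
  · simp [gmul_eq, ginv]
  · simp [gmul_eq, ginv, bracket_self hskew]
    ring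

lemma gmul_ginv_cancel (hskew : ∀ s, (b s).transpose = -(b s)) (P Q : G m n) :
    gmul b P (gmul b (ginv P) Q) = Q := by
  ext
  · simp [gmul_eq, ginv]
  · simp [gmul_eq, ginv, bracket_self hskew]
    ring

lemma continuous_gmul : Continuous fun p : G m n × G m n => gmul b p.1 p.2 := by
  simp only [gmul_eq]
  fun_prop

lemma continuous_ginv : Continuous (ginv : G m n → G m n) := by
  unfold ginv
  fun_prop

/-- Two horizontal steps and their opposites produce the vertical vector `⟨Bv, w⟩`. -/
lemma gmul_commutator (hskew : ∀ s, (b s).transpose = -(b s)) (P : G m n) (v w : Fin m → ℝ) :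
    gmul b (gmul b (gmul b (gmul b P (v, 0)) (w, 0)) (-v, 0)) (-w, 0) =
      gmul b P (0, bracket b v w) := by
  have h := bracket_swap hskew w v
  ext s
  · simp [gmul_eq]
    ring
  · simp [gmul_eq, bracket_self hskew, h]
    ring

end Algebra

section Norms

lemma norm_le_enorm {d : ℕ} (x : Fin d → ℝ) : ‖x‖ ≤ enorm x := by
  refine (pi_norm_le_iff_of_nonneg (Real.sqrt_nonneg _)).2 fun i => ?_
  exact Real.abs_le_sqrt (Finset.single_le_sum (f := fun i => x i ^ 2)
    (fun j _ => sq_nonneg _) (Finset.mem_univ i))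

lemma enorm_le {d : ℕ} (x : Fin d → ℝ) : enorm x ≤ (d + 1) * ‖x‖ := by
  refine Real.sqrt_le_iff.2 ⟨by positivity, ?_⟩
  have h : ∑ i, x i ^ 2 ≤ ∑ _i : Fin d, ‖x‖ ^ 2 := Finset.sum_le_sum fun i _ => by
    rw [← sq_abs (x i)]
    gcongr
    exact norm_le_pi_norm x i
  simp only [Finset.sum_const, Finset.card_univ, Fintype.card_fin, nsmul_eq_mul] at h
  nlinarith [sq_nonneg ‖x‖, mul_nonneg (Nat.cast_nonneg (α := ℝ) d) (sq_nonneg ‖x‖),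
    mul_nonneg (sq_nonneg (d : ℝ)) (sq_nonneg ‖x‖)]

lemma enorm_smul {d : ℕ} (c : ℝ) (x : Fin d → ℝ) : enorm (c • x) = |c| * enorm x := by
  simp only [enorm, Pi.smul_apply, smul_eq_mul, mul_pow, ← Finset.mul_sum]
  rw [Real.sqrt_mul (sq_nonneg c), Real.sqrt_sq_eq_abs]

lemma enorm_zero {d : ℕ} : enorm (0 : Fin d → ℝ) = 0 := by simp [enorm]

/-- The homogeneous quasi-norm built from supremum norms. -/
def gauge {m n : ℕ} (P : G m n) : ℝ := ‖P.1‖ + √‖P.2‖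

lemma gauge_nonneg {m n : ℕ} (P : G m n) : 0 ≤ gauge P := by unfold gauge; positivity

lemma gauge_le_qnorm {m n : ℕ} (P : G m n) : gauge P ≤ qnorm P :=
  add_le_add (norm_le_enorm _) (Real.sqrt_le_sqrt (norm_le_enorm _))

lemma eventually_of_gauge_lt {m n : ℕ} {p : G m n → Prop} (hp : ∀ᶠ g in 𝓝 0, p g) :
    ∃ r > 0, ∀ g, gauge g < r → p g := by
  obtain ⟨r, hr, h⟩ := Metric.eventually_nhds_iff.1 hp
  refine ⟨min r (√r), by positivity, fun g hg => h ?_⟩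
  have h1 : ‖g.1‖ < r := by
    have := Real.sqrt_nonneg ‖g.2‖
    unfold gauge at hg
    linarith [min_le_left r (√r)]
  have h2 : √‖g.2‖ < √r := by
    have := norm_nonneg g.1
    unfold gauge at hg
    linarith [min_le_right r (√r)]
  rw [dist_zero_right, Prod.norm_def]
  exact max_lt h1 (((Real.sqrt_lt_sqrt_iff (norm_nonneg _)).1 h2))

lemma exists_gauge_gmul_le {m n : ℕ} (b : Fin n → Matrix (Fin m) (Fin m) ℝ) :
    ∃ C > 0, ∀ (g : G m n) (v : Fin m → ℝ), gauge (gmul b g (v, 0)) ≤ C * (gauge g + ‖v‖) := by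
  obtain ⟨K, hKdef⟩ : ∃ K, K = ‖bracket b‖ := ⟨_, rfl⟩
  have hK : 0 ≤ K := hKdef ▸ norm_nonneg (bracket b)
  refine ⟨K + 2, by positivity, fun g v => ?_⟩
  have h1 : ‖g.1 + v‖ ≤ ‖g.1‖ + ‖v‖ := norm_add_le _ _
  have h2 : √‖g.2 + 0 + (1 / 2 : ℝ) • bracket b g.1 v‖ ≤ √‖g.2‖ + (K + 1) * (‖g.1‖ + ‖v‖) := by
    refine Real.sqrt_le_iff.2 ⟨by positivity, ?_⟩
    have h3 : ‖g.2 + 0 + (1 / 2 : ℝ) • bracket b g.1 v‖ ≤ ‖g.2‖ + 1 / 2 * (K * ‖g.1‖ * ‖v‖) := by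
      refine (norm_add_le _ _).trans ?_
      rw [add_zero, norm_smul, Real.norm_of_nonneg (by norm_num : (0 : ℝ) ≤ 1 / 2)]
      gcongr
      exact hKdef ▸ (bracket b).le_opNorm₂ _ _
    have h4 := Real.sq_sqrt (norm_nonneg g.2)
    have hx := norm_nonneg g.1
    have hv := norm_nonneg v
    have h5 : 0 ≤ 2 * √‖g.2‖ * ((K + 1) * (‖g.1‖ + ‖v‖)) := by positivity
    have h6 : K * ‖g.1‖ * ‖v‖ ≤ ((K + 1) * (‖g.1‖ + ‖v‖)) ^ 2 := by
      have : ‖g.1‖ * ‖v‖ ≤ (‖g.1‖ + ‖v‖) ^ 2 := by nlinarith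
      have : K ≤ (K + 1) ^ 2 := by nlinarith
      rw [mul_pow, mul_assoc]
      gcongr
    have h7 : 0 ≤ K * ‖g.1‖ * ‖v‖ := by positivity
    nlinarith
  have h8 := Real.sqrt_nonneg ‖g.2‖
  simp only [gmul_eq, gauge]
  nlinarith [mul_nonneg hK h8]

end Norms

section StrictDifferentiability

variable {m n k : ℕ} {b : Fin n → Matrix (Fin m) (Fin m) ℝ} {U : Set (G m n)}
  {f : G m n → Fin k → ℝ} {gradf : G m n → Matrix (Fin k) (Fin m) ℝ}

lemma C1G.hasDerivAt (hskew : ∀ s, (b s).transpose = -(b s)) (hU : IsOpen U)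
    (hf : C1G m n k b U f gradf) (P : G m n) (v : Fin m → ℝ) (t : ℝ)
    (ht : gmul b P (t • v, 0) ∈ U) :
    HasDerivAt (fun s : ℝ => f (gmul b P (s • v, 0))) (jac (gradf (gmul b P (t • v, 0))) v) t := by
  rw [hasDerivAt_iff_isLittleO, Asymptotics.isLittleO_iff]
  intro c hc
  have he : 0 ≤ enorm v := Real.sqrt_nonneg _
  obtain ⟨r, hr, h⟩ := hf.2.2 _ ht (c / (enorm v + 1)) (by positivity)
  have hcont : Continuous fun s : ℝ => gmul b P (s • v, 0) :=
    continuous_gmul.comp (by fun_prop : Continuous fun s : ℝ => (P, ((s • v, 0) : G m n)))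
  have hstep (s : ℝ) : gmul b (ginv (gmul b P (t • v, 0))) (gmul b P (s • v, 0)) =
      ((s - t) • v, 0) := by
    have : gmul b P (s • v, 0) = gmul b (gmul b P (t • v, 0)) ((s - t) • v, 0) := by
      rw [gmul_assoc]
      congr 1
      ext <;> simp [gmul_eq, bracket_self hskew]
      ring
    rw [this, ginv_gmul_cancel hskew]
  have hq (s : ℝ) : qnorm (((s - t) • v, 0) : G m n) = |s - t| * enorm v := by
    simp [qnorm, enorm_smul, enorm_zero]
  have hsmall : ∀ᶠ s in 𝓝 t, |s - t| * enorm v < r := by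
    have : Tendsto (fun s : ℝ => |s - t| * enorm v) (𝓝 t) (𝓝 (|t - t| * enorm v)) :=
      (Continuous.tendsto (by fun_prop) t)
    refine this.eventually_lt_const ?_
    simpa using hr
  filter_upwards [hsmall, hcont.continuousAt.preimage_mem_nhds (hU.mem_nhds ht)] with s hs hsU
  have h1 := h _ hsU (by rw [hstep, hq]; exact hs)
  rw [hstep, hq] at h1
  have h2 := (norm_le_enorm _).trans h1
  have h3 : c / (enorm v + 1) * (|s - t| * enorm v) ≤ c * ‖s - t‖ := by
    rw [Real.norm_eq_abs, div_mul_eq_mul_div, div_le_iff₀ (by positivity)]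
    nlinarith [mul_nonneg hc.le (abs_nonneg (s - t))]
  refine le_trans (le_of_eq ?_) (h2.trans h3)
  congr 1
  ext j
  simp only [Pi.sub_apply, Pi.smul_apply, smul_eq_mul, jac_apply, Matrix.mulVec, dotProduct,
    Finset.mul_sum]
  congr 1
  refine Finset.sum_congr rfl fun i _ => ?_
  simp [gmul]
  ring

/-- Strict differentiability along horizontal segments. -/
lemma C1G.eventually_horizontal (hskew : ∀ s, (b s).transpose = -(b s)) (hU : IsOpen U)
    (hf : C1G m n k b U f gradf) {P₀ : G m n} (hP₀ : P₀ ∈ U) {ε : ℝ} (hε : 0 < ε) :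
    ∀ᶠ p : G m n × (Fin m → ℝ) in 𝓝 (P₀, 0),
      ‖f (gmul b p.1 (p.2, 0)) - f p.1 - jac (gradf P₀) p.2‖ ≤ ε * ‖p.2‖ := by
  have hV : ∀ᶠ Q in 𝓝 P₀, Q ∈ U ∧ ‖jac (gradf Q) - jac (gradf P₀)‖ ≤ ε := by
    refine (hU.eventually_mem hP₀).and ?_
    have h1 : ContinuousAt (fun Q => jac (gradf Q)) P₀ :=
      jac.continuous.continuousAt.comp (hf.2.1.continuousAt (hU.mem_nhds hP₀))
    filter_upwards [Metric.continuousAt_iff'.1 h1 ε hε] with Q hQ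
    rw [← dist_eq_norm]
    exact hQ.le
  have hcont : Continuous fun z : (G m n × (Fin m → ℝ)) × ℝ =>
      gmul b z.1.1 (z.2 • z.1.2, 0) :=
    continuous_gmul.comp (by fun_prop :
      Continuous fun z : (G m n × (Fin m → ℝ)) × ℝ => (z.1.1, ((z.2 • z.1.2, 0) : G m n)))
  have htube : ∀ᶠ p : G m n × (Fin m → ℝ) in 𝓝 (P₀, 0), ∀ t ∈ Icc (0 : ℝ) 1,
      gmul b p.1 (t • p.2, 0) ∈ U ∧
        ‖jac (gradf (gmul b p.1 (t • p.2, 0))) - jac (gradf P₀)‖ ≤ ε := by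
    refine isCompact_Icc.eventually_forall_of_forall_eventually fun t _ => ?_
    have hlim := hcont.tendsto ((P₀, 0), t)
    have h0 : gmul b P₀ (t • (0 : Fin m → ℝ), 0) = P₀ := by
      rw [smul_zero]
      exact gmul_zero P₀
    simp only [h0] at hlim
    exact hlim.eventually hV
  filter_upwards [htube] with ⟨Q, v⟩ h
  have h1 := norm_image_sub_le_of_norm_deriv_le_segment_01'
    (f := fun t : ℝ => f (gmul b Q (t • v, 0)) - t • jac (gradf P₀) v)
    (f' := fun t => jac (gradf (gmul b Q (t • v, 0))) v - jac (gradf P₀) v) (C := ε * ‖v‖)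
    (fun t ht => ((hf.hasDerivAt hskew hU Q v t (h t ht).1).sub
      (by simpa using (hasDerivAt_id t).smul_const (jac (gradf P₀) v))).hasDerivWithinAt)
    (fun t ht => by
      rw [← _root_.sub_apply]
      exact ContinuousLinearMap.le_of_opNorm_le _ (h t (Ico_subset_Icc_self ht)).2 v)
  have h0 : gmul b Q (0, 0) = Q := gmul_zero Q
  simp only [one_smul, zero_smul, h0, sub_zero] at h1
  rwa [sub_right_comm]

/-- Increments along commutators of horizontal vectors. -/
lemma C1G.eventually_commutator (hskew : ∀ s, (b s).transpose = -(b s)) (hU : IsOpen U)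
    (hf : C1G m n k b U f gradf) {P₀ : G m n} (hP₀ : P₀ ∈ U) {ε : ℝ} (hε : 0 < ε) :
    ∀ᶠ p : G m n × (Fin m → ℝ) × (Fin m → ℝ) in 𝓝 (P₀, 0, 0),
      ‖f (gmul b p.1 (0, bracket b p.2.1 p.2.2)) - f p.1‖ ≤ ε * (2 * (‖p.2.1‖ + ‖p.2.2‖)) := by
  have h := hf.eventually_horizontal hskew hU hP₀ hε
  have hz : gmul b P₀ (0, 0) = P₀ := gmul_zero P₀
  have hmul {u : G m n × (Fin m → ℝ) × (Fin m → ℝ) → G m n}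
      {v : G m n × (Fin m → ℝ) × (Fin m → ℝ) → Fin m → ℝ}
      (hu : Continuous u) (hv : Continuous v) : Continuous fun p => gmul b (u p) (v p, 0) :=
    continuous_gmul.comp (hu.prodMk (hv.prodMk continuous_const))
  have c0 : Continuous fun p : G m n × (Fin m → ℝ) × (Fin m → ℝ) => p.1 := continuous_fst
  have cv : Continuous fun p : G m n × (Fin m → ℝ) × (Fin m → ℝ) => p.2.1 := by fun_prop
  have cw : Continuous fun p : G m n × (Fin m → ℝ) × (Fin m → ℝ) => p.2.2 := by fun_prop
  have c1 := hmul c0 cv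
  have c2 := hmul c1 cw
  have c3 := hmul c2 cv.neg
  have t0 := (c0.prodMk cv).tendsto (P₀, 0, 0)
  have t1 := (c1.prodMk cw).tendsto (P₀, 0, 0)
  have t2 := (c2.prodMk cv.neg).tendsto (P₀, 0, 0)
  have t3 := (c3.prodMk cw.neg).tendsto (P₀, 0, 0)
  simp only [hz, Pi.neg_apply, neg_zero] at t0 t1 t2 t3
  filter_upwards [t0.eventually h, t1.eventually h, t2.eventually h, t3.eventually h]
    with ⟨Q, v, w⟩ h0 h1 h2 h3
  rw [gmul_commutator hskew] at h3
  simp only [map_neg, norm_neg] at h0 h1 h2 h3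
  refine le_trans (le_of_eq ?_) ((norm_add₄_le).trans
    ((add_le_add (add_le_add (add_le_add h0 h1) h2) h3).trans (le_of_eq (by ring))))
  congr 1
  abel

lemma C1G.eventually_smul_bracket (hskew : ∀ s, (b s).transpose = -(b s)) (hU : IsOpen U)
    (hf : C1G m n k b U f gradf) {P₀ : G m n} (hP₀ : P₀ ∈ U) {ε : ℝ} (hε : 0 < ε)
    {v w : Fin m → ℝ} (hv : ‖v‖ ≤ 1) (hw : ‖w‖ ≤ 1) :
    ∀ᶠ p : G m n × ℝ in 𝓝 (P₀, 0),
      ‖f (gmul b p.1 (0, p.2 • bracket b v w)) - f p.1‖ ≤ 4 * ε * √|p.2| := by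
  have hcont : Continuous fun p : G m n × ℝ =>
      (p.1, √|p.2| • v, (√(max p.2 0) - √(max (-p.2) 0)) • w) := by fun_prop
  have ht := hcont.tendsto (P₀, 0)
  simp only [abs_zero, Real.sqrt_zero, zero_smul, neg_zero, max_self, sub_self] at ht
  filter_upwards [ht.eventually (hf.eventually_commutator hskew hU hP₀ hε)] with ⟨Q, c⟩ h
  have habs : |√(max c 0) - √(max (-c) 0)| = √|c| ∧
      √|c| * (√(max c 0) - √(max (-c) 0)) = c := by
    rcases le_total 0 c with hc | hc
    · simp [hc, abs_of_nonneg, Real.sqrt_nonneg]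
    · simp [hc, abs_of_nonpos, Real.sqrt_nonneg]
  simp only [map_smul, _root_.smul_apply, smul_smul, norm_smul, Real.norm_eq_abs, habs.1,
    mul_comm _ √|c|, habs.2, abs_of_nonneg (Real.sqrt_nonneg |c|)] at h
  refine h.trans ?_
  have : √|c| * ‖v‖ + √|c| * ‖w‖ ≤ 2 * √|c| := by
    nlinarith [Real.sqrt_nonneg |c|]
  nlinarith

lemma C1G.eventually_sum_bracket (hskew : ∀ s, (b s).transpose = -(b s)) (hU : IsOpen U)
    (hf : C1G m n k b U f gradf) {P₀ : G m n} (hP₀ : P₀ ∈ U) {ε : ℝ} (hε : 0 < ε)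
    {ι : Type*} [Fintype ι] {v w : ι → Fin m → ℝ} (hv : ∀ i, ‖v i‖ ≤ 1) (hw : ∀ i, ‖w i‖ ≤ 1)
    (S : Finset ι) :
    ∀ᶠ p : G m n × (ι → ℝ) in 𝓝 (P₀, 0),
      ‖f (gmul b p.1 (0, ∑ i ∈ S, p.2 i • bracket b (v i) (w i))) - f p.1‖ ≤
        ∑ i ∈ S, 4 * ε * √|p.2 i| := by
  classical
  have hz : gmul b P₀ (0, 0) = P₀ := gmul_zero P₀
  induction S using Finset.induction_on with
  | empty =>
    refine Eventually.of_forall fun p => ?_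
    have : gmul b p.1 (0, 0) = p.1 := gmul_zero p.1
    simp [this]
  | insert a S ha ih =>
    have hcont : Continuous fun p : G m n × (ι → ℝ) =>
        (gmul b p.1 (0, ∑ i ∈ S, p.2 i • bracket b (v i) (w i)), p.2 a) :=
      (continuous_gmul.comp (continuous_fst.prodMk (by fun_prop))).prodMk (by fun_prop)
    have ht := hcont.tendsto (P₀, 0)
    simp only [Pi.zero_apply, zero_smul, Finset.sum_const_zero, hz] at ht
    filter_upwards [ih, ht.eventually (hf.eventually_smul_bracket hskew hU hP₀ hε (hv a) (hw a))]
      with p h1 h2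
    have hsplit : gmul b (gmul b p.1 (0, ∑ i ∈ S, p.2 i • bracket b (v i) (w i)))
        (0, p.2 a • bracket b (v a) (w a)) =
          gmul b p.1 (0, ∑ i ∈ insert a S, p.2 i • bracket b (v i) (w i)) := by
      rw [gmul_assoc, Finset.sum_insert ha]
      congr 1
      simp [gmul_eq, add_comm]
    rw [hsplit] at h2
    have h3 := (norm_add_le _ _).trans (add_le_add h2 h1)
    rw [sub_add_sub_cancel] at h3
    rwa [Finset.sum_insert ha (f := fun i => 4 * ε * √|p.2 i|)]

/-- The brackets of coordinate vectors span the vertical layer. -/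
lemma exists_bracket_coordinates (hind : LinearIndependent ℝ b) :
    ∃ R : (Fin n → ℝ) →ₗ[ℝ] (Fin m × Fin m → ℝ), ∀ y,
      ∑ p, R y p • bracket b (Pi.single p.2 1) (Pi.single p.1 1) = y := by
  let T : (Fin n → ℝ) →ₗ[ℝ] (Fin m × Fin m → ℝ) :=
    { toFun := fun y p => (Fintype.linearCombination ℝ b y) p.1 p.2
      map_add' := fun x y => by ext; simp
      map_smul' := fun c x => by ext; simp }
  have hT : LinearMap.ker T = ⊥ := by
    refine LinearMap.ker_eq_bot'.2 fun y hy => ?_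
    have h0 : Fintype.linearCombination ℝ b y = 0 := by
      ext i j
      exact congrFun hy (i, j)
    ext s
    exact Fintype.linearIndependent_iff.1 hind y
      (by simpa [Fintype.linearCombination_apply] using h0) s
  obtain ⟨L, hL⟩ := T.exists_leftInverse_of_injective hT
  let e (p : Fin m × Fin m) : Fin m × Fin m → ℝ := fun q => if p = q then 1 else 0
  have key (s t : Fin n) :
      ∑ p : Fin m × Fin m, b s p.1 p.2 * L (e p) t = (Pi.single s 1 : Fin n → ℝ) t := by
    have h1 := congrFun (LinearMap.congr_fun hL (Pi.single s 1)) t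
    rw [LinearMap.comp_apply, LinearMap.id_apply, LinearMap.pi_apply_eq_sum_univ L] at h1
    rw [← h1, Finset.sum_apply]
    refine Finset.sum_congr rfl fun p _ => ?_
    simp [T, e, Fintype.linearCombination_apply_single]
  refine ⟨LinearMap.pi fun p => ∑ t, L (e p) t • LinearMap.proj t, fun y => ?_⟩
  ext s
  calc (∑ p : Fin m × Fin m, (LinearMap.pi fun p => ∑ t, L (e p) t • LinearMap.proj t) y p •
        bracket b (Pi.single p.2 1) (Pi.single p.1 1)) s
      = ∑ p : Fin m × Fin m, ∑ t, y t * (b s p.1 p.2 * L (e p) t) := by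
        rw [Finset.sum_apply]
        refine Finset.sum_congr rfl fun p _ => ?_
        simp only [LinearMap.pi_apply, LinearMap.sum_apply, LinearMap.smul_apply,
          LinearMap.proj_apply, Pi.smul_apply, bracket_apply, smul_eq_mul, Finset.sum_mul]
        refine Finset.sum_congr rfl fun t _ => ?_
        simp
        ring
    _ = y s := by
        rw [Finset.sum_comm]
        simp_rw [← Finset.mul_sum, key]
        simp [Pi.single_apply]

/-- Increments along vertical directions. -/
lemma C1G.eventually_vertical (hskew : ∀ s, (b s).transpose = -(b s))
    (hind : LinearIndependent ℝ b) (hU : IsOpen U)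
    (hf : C1G m n k b U f gradf) {P₀ : G m n} (hP₀ : P₀ ∈ U) {ε : ℝ} (hε : 0 < ε) :
    ∀ᶠ p : G m n × (Fin n → ℝ) in 𝓝 (P₀, 0),
      ‖f (gmul b p.1 (0, p.2)) - f p.1‖ ≤ ε * √‖p.2‖ := by
  obtain ⟨R, hR⟩ := exists_bracket_coordinates hind
  set R' := LinearMap.toContinuousLinearMap R
  have hC : 0 < (m * m : ℝ) * (4 * √‖R'‖) + 1 := by positivity
  have hs (i : Fin m) : ‖(Pi.single i 1 : Fin m → ℝ)‖ ≤ 1 := by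
    simp [Pi.norm_single]
  have h := hf.eventually_sum_bracket hskew hU hP₀ (div_pos hε hC)
    (v := fun p : Fin m × Fin m => Pi.single p.2 1) (w := fun p => Pi.single p.1 1)
    (fun p => hs p.2) (fun p => hs p.1) Finset.univ
  have hcont : Continuous fun p : G m n × (Fin n → ℝ) => (p.1, R' p.2) := by fun_prop
  have ht := hcont.tendsto (P₀, 0)
  rw [map_zero] at ht
  filter_upwards [ht.eventually h] with ⟨Q, y⟩ h1
  have hR' : ∑ p, R' y p • bracket b (Pi.single p.2 1) (Pi.single p.1 1) = y := hR y
  rw [hR'] at h1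
  refine h1.trans ?_
  have h2 (p : Fin m × Fin m) : √|R' y p| ≤ √‖R'‖ * √‖y‖ := by
    rw [← Real.sqrt_mul (norm_nonneg R')]
    exact Real.sqrt_le_sqrt ((norm_le_pi_norm (R' y) p).trans (R'.le_opNorm y))
  calc ∑ p, 4 * (ε / (m * m * (4 * √‖R'‖) + 1)) * √|R' y p|
      ≤ ∑ _p : Fin m × Fin m, 4 * (ε / (m * m * (4 * √‖R'‖) + 1)) * (√‖R'‖ * √‖y‖) :=
        Finset.sum_le_sum fun p _ => mul_le_mul_of_nonneg_left (h2 p) (by positivity)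
    _ = ε / (m * m * (4 * √‖R'‖) + 1) * (m * m * (4 * √‖R'‖)) * √‖y‖ := by
        simp
        ring
    _ ≤ ε * √‖y‖ := by
        gcongr
        rw [div_mul_eq_mul_div, div_le_iff₀ hC]
        linarith

/-- Strict differentiability of maps of class `C¹_G`. -/
lemma C1G.eventually_strict (hskew : ∀ s, (b s).transpose = -(b s))
    (hind : LinearIndependent ℝ b) (hU : IsOpen U)
    (hf : C1G m n k b U f gradf) {P₀ : G m n} (hP₀ : P₀ ∈ U) {ε : ℝ} (hε : 0 < ε) :
    ∀ᶠ p : G m n × G m n in 𝓝 (P₀, P₀),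
      ‖f p.2 - f p.1 - jac (gradf P₀) (p.2.1 - p.1.1)‖ ≤ ε * gauge (gmul b (ginv p.1) p.2) := by
  have hz : gmul b P₀ (0, 0) = P₀ := gmul_zero P₀
  have hinv : gmul b (ginv P₀) P₀ = 0 := by
    simpa only [gmul_zero] using ginv_gmul_cancel hskew P₀ 0
  have hg : Continuous fun p : G m n × G m n => gmul b (ginv p.1) p.2 :=
    continuous_gmul.comp ((continuous_ginv.comp continuous_fst).prodMk continuous_snd)
  have hc1 : Continuous fun p : G m n × G m n => (p.1, (gmul b (ginv p.1) p.2).1) := by fun_prop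
  have hc2 : Continuous fun p : G m n × G m n =>
      (gmul b p.1 ((gmul b (ginv p.1) p.2).1, 0), (gmul b (ginv p.1) p.2).2) :=
    (continuous_gmul.comp (continuous_fst.prodMk (hg.fst.prodMk continuous_const))).prodMk hg.snd
  have ht1 := hc1.tendsto (P₀, P₀)
  have ht2 := hc2.tendsto (P₀, P₀)
  simp only [hinv, Prod.fst_zero, Prod.snd_zero, hz] at ht1 ht2
  filter_upwards [ht1.eventually (hf.eventually_horizontal hskew hU hP₀ hε),
    ht2.eventually (hf.eventually_vertical hskew hind hU hP₀ hε)] with ⟨P, Q⟩ h1 h2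
  set g := gmul b (ginv P) Q with hgdef
  have hQ : gmul b (gmul b P (g.1, 0)) (0, g.2) = Q := by
    rw [← gmul_ginv_cancel (b := b) hskew P Q, ← hgdef, gmul_assoc]
    congr 1
    simp [gmul_eq]
  have hx : g.1 = Q.1 - P.1 := by
    simp [hgdef, gmul_eq, ginv, sub_eq_neg_add]
  simp only [hQ] at h1 h2
  rw [← hx, gauge, mul_add, add_comm (ε * _)]
  refine le_trans (le_of_eq ?_) ((norm_add_le _ _).trans (add_le_add h2 h1))
  congr 1
  abel

end StrictDifferentiability

/-- An implicit function theorem for maps that are strictly differentiable in the second variable,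
uniformly with respect to a parameter. -/
lemma exists_implicit_function {X E : Type*} [TopologicalSpace X] [NormedAddCommGroup E]
    [NormedSpace ℝ E] [CompleteSpace E] {F : X → E → E} {a₀ : X} {v₀ : E} (e : E ≃L[ℝ] E)
    (h₀ : F a₀ v₀ = 0) {V : Set (X × E)} (hV : IsOpen V) (hmem : (a₀, v₀) ∈ V)
    (hcont : ContinuousOn (fun p : X × E => F p.1 p.2) V)
    (hstrict : ∀ ε > 0, ∀ᶠ p : X × E × E in 𝓝 (a₀, v₀, v₀),
      ‖F p.1 p.2.1 - F p.1 p.2.2 - e (p.2.1 - p.2.2)‖ ≤ ε * ‖p.2.1 - p.2.2‖) :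
    ∃ O : Set X, IsOpen O ∧ a₀ ∈ O ∧ ∃ δ > 0, ∃ φ : X → E,
      (∀ a ∈ O, ∀ v ∈ Metric.ball v₀ δ, (a, v) ∈ V) ∧ ContinuousOn φ O ∧
      ∀ a ∈ O, φ a ∈ Metric.ball v₀ δ ∧ ∀ v ∈ Metric.ball v₀ δ, F a v = 0 ↔ v = φ a := by
  obtain ⟨K, hK, hKe⟩ : ∃ K : ℝ, 0 < K ∧ ∀ v, ‖e.symm v‖ ≤ K * ‖v‖ :=
    ⟨‖(e.symm : E →L[ℝ] E)‖ + 1, by positivity,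
      (e.symm : E →L[ℝ] E).le_of_opNorm_le (by linarith)⟩
  have hVe : ∀ᶠ p : X × E × E in 𝓝 (a₀, v₀, v₀), (p.1, p.2.1) ∈ V :=
    (Continuous.tendsto (by fun_prop : Continuous fun p : X × E × E => (p.1, p.2.1))
      (a₀, v₀, v₀)).eventually (hV.mem_nhds hmem)
  have hall := (hstrict (1 / (2 * K)) (by positivity)).and hVe
  rw [nhds_prod_eq, eventually_prod_iff] at hall
  obtain ⟨pa, hpa, pb, hpb, hall⟩ := hall
  obtain ⟨δ, hδ, hpb⟩ := Metric.eventually_nhds_iff_ball.1 hpb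
  have hcontX {a v} (h : (a, v) ∈ V) : ContinuousAt (fun a => F a v) a :=
    ContinuousAt.comp (f := fun a => (a, v)) (hcont.continuousAt (hV.mem_nhds h)) (by fun_prop)
  have hsmall : ∀ᶠ a in 𝓝 a₀, ‖F a v₀‖ < δ / (4 * K) :=
    (hcontX hmem).norm.eventually_lt_const (by simpa [h₀] using by positivity)
  obtain ⟨O, hO, hOo, haO⟩ := eventually_nhds_iff.1 (hpa.and hsmall)
  have happrox {a} (ha : a ∈ O) {v w} (hv : v ∈ Metric.ball v₀ δ) (hw : w ∈ Metric.ball v₀ δ) :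
      ‖F a v - F a w - e (v - w)‖ ≤ 1 / (2 * K) * ‖v - w‖ ∧ (a, v) ∈ V :=
    hall (hO a ha).1 (hpb (v, w) (by rw [← ball_prod_same]; exact ⟨hv, hw⟩))
  have hanti {a} (ha : a ∈ O) {v w} (hv : v ∈ Metric.ball v₀ δ) (hw : w ∈ Metric.ball v₀ δ) :
      ‖v - w‖ ≤ 2 * K * ‖F a v - F a w‖ := by
    have h1 := (happrox ha hv hw).1
    have h2 := hKe (e (v - w))
    rw [e.symm_apply_apply] at h2
    have h3 : ‖e (v - w)‖ ≤ ‖F a v - F a w‖ + 1 / (2 * K) * ‖v - w‖ := by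
      have := norm_sub_norm_le (e (v - w)) (F a v - F a w)
      rw [norm_sub_rev (e (v - w))] at this
      linarith
    have h4 : K * (1 / (2 * K) * ‖v - w‖) = ‖v - w‖ / 2 := by field_simp
    nlinarith [mul_le_mul_of_nonneg_left h3 hK.le]
  have hex : ∀ a, ∃ v, a ∈ O → v ∈ Metric.ball v₀ δ ∧ F a v = 0 := by
    intro a
    by_cases ha : a ∈ O
    swap
    · exact ⟨v₀, fun h => absurd h ha⟩
    let R : (e : E →L[ℝ] E).NonlinearRightInverse :=
      { toFun := e.symm, nnnorm := ⟨K, hK.le⟩, bound' := hKe, right_inv' := e.apply_symm_apply }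
    have hA : ApproximatesLinearOn (F a) (e : E →L[ℝ] E) (Metric.ball v₀ δ)
        ⟨1 / (2 * K), by positivity⟩ := fun v hv w hw => (happrox ha hv hw).1
    have hsub : Metric.closedBall v₀ (δ / 2) ⊆ Metric.ball v₀ δ :=
      Metric.closedBall_subset_ball (by linarith)
    have hsurj := hA.surjOn_closedBall_of_nonlinearRightInverse R (by positivity) hsub
    have hz : (0 : E) ∈ Metric.closedBall (F a v₀) ((K⁻¹ - 1 / (2 * K)) * (δ / 2)) := by
      rw [Metric.mem_closedBall, dist_zero_left]
      refine (hO a ha).2.le.trans (le_of_eq ?_)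
      field_simp
      norm_num
    obtain ⟨v, hv, hv0⟩ := hsurj hz
    exact ⟨v, fun _ => ⟨hsub hv, hv0⟩⟩
  choose φ hφ using hex
  refine ⟨O, hOo, haO, δ, hδ, φ, fun a ha v hv => (happrox ha hv hv).2, ?_, fun a ha =>
    ⟨(hφ a ha).1, fun v hv => ⟨fun h => ?_, fun h => h ▸ (hφ a ha).2⟩⟩⟩
  · intro a ha
    refine ContinuousAt.continuousWithinAt ?_
    have hc := hcontX (happrox ha (hφ a ha).1 (hφ a ha).1).2
    rw [ContinuousAt, tendsto_iff_norm_sub_tendsto_zero]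
    have hlim : Tendsto (fun a' => 2 * K * ‖F a' (φ a)‖) (𝓝 a) (𝓝 0) := by
      simpa [(hφ a ha).2] using (hc.norm.const_mul (2 * K)).tendsto
    refine squeeze_zero' (Eventually.of_forall fun _ => norm_nonneg _) ?_ hlim
    filter_upwards [hOo.mem_nhds ha] with a' ha'
    have := hanti ha' (hφ a' ha').1 (hφ a ha).1
    rwa [(hφ a' ha').2, zero_sub, norm_neg] at this
  · have := hanti ha hv (hφ a ha).1
    rw [h, (hφ a ha).2, sub_zero, norm_zero, mul_zero] at this
    exact sub_eq_zero.1 (norm_le_zero_iff.1 this)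

section Splitting

variable {m n k : ℕ} {b : Fin n → Matrix (Fin m) (Fin m) ℝ}

/-- The inclusion of `ℝ^k` as the first `k` coordinates of `ℝ^m`. -/
def hemb (m k : ℕ) : (Fin k → ℝ) →L[ℝ] (Fin m → ℝ) :=
  LinearMap.toContinuousLinearMap
    { toFun := fun v j => if h : (j : ℕ) < k then v ⟨(j : ℕ), h⟩ else 0
      map_add' := fun x y => by ext j; by_cases h : (j : ℕ) < k <;> simp [h]
      map_smul' := fun c x => by ext j; by_cases h : (j : ℕ) < k <;> simp [h] }

/-- The inclusion of `ℝ^(m-k)` as the last `m - k` coordinates of `ℝ^m`. -/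
def wemb (m k : ℕ) : (Fin (m - k) → ℝ) →L[ℝ] (Fin m → ℝ) :=
  LinearMap.toContinuousLinearMap
    { toFun := fun a j => if h : (j : ℕ) < k then 0 else
        a ⟨(j : ℕ) - k, by have := j.isLt; omega⟩
      map_add' := fun x y => by ext j; by_cases h : (j : ℕ) < k <;> simp [h]
      map_smul' := fun c x => by ext j; by_cases h : (j : ℕ) < k <;> simp [h] }

/-- The projection of `ℝ^m` onto its first `k` coordinates. -/
def hproj (hk : k ≤ m) (x : Fin m → ℝ) : Fin k → ℝ := fun j => x (Fin.castLE hk j)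

/-- The projection of `ℝ^m` onto its last `m - k` coordinates. -/
def wproj (m k : ℕ) (x : Fin m → ℝ) : Fin (m - k) → ℝ :=
  fun i => x ⟨k + (i : ℕ), by have := i.isLt; omega⟩

lemma hemb_apply (v : Fin k → ℝ) (j : Fin m) :
    hemb m k v j = if h : (j : ℕ) < k then v ⟨(j : ℕ), h⟩ else 0 := rfl

lemma wemb_apply (a : Fin (m - k) → ℝ) (j : Fin m) :
    wemb m k a j = if h : (j : ℕ) < k then 0 else
      a ⟨(j : ℕ) - k, by have := j.isLt; omega⟩ := rfl

lemma embH_eq (v : Fin k → ℝ) : embH m n k v = (hemb m k v, 0) := rfl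

lemma embW_eq (A : W m n k) : embW m n k A = (wemb m k A.1, A.2) := rfl

lemma wproj_add (v : Fin k → ℝ) (a : Fin (m - k) → ℝ) :
    wproj m k (wemb m k a + hemb m k v) = a := by
  ext j
  simp [wproj, hemb_apply, wemb_apply]

lemma wemb_wproj_add (hk : k ≤ m) (x : Fin m → ℝ) :
    wemb m k (wproj m k x) + hemb m k (hproj hk x) = x := by
  ext j
  by_cases h : (j : ℕ) < k
  · simp [hproj, hemb_apply, wemb_apply, h]
  · have : k + ((j : ℕ) - k) = j := by omega
    simp [wproj, hemb_apply, wemb_apply, h, this]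

lemma norm_hemb_le (v : Fin k → ℝ) : ‖hemb m k v‖ ≤ ‖v‖ := by
  refine (pi_norm_le_iff_of_nonneg (norm_nonneg v)).2 fun j => ?_
  rw [hemb_apply]
  split_ifs
  · exact norm_le_pi_norm v _
  · simp

lemma norm_le_norm_wemb (a : Fin (m - k) → ℝ) : ‖a‖ ≤ ‖wemb m k a‖ := by
  refine (pi_norm_le_iff_of_nonneg (norm_nonneg _)).2 fun i => ?_
  have h := norm_le_pi_norm (wemb m k a) ⟨k + (i : ℕ), by have := i.isLt; omega⟩
  simpa [wemb_apply] using h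

lemma continuous_hproj (hk : k ≤ m) : Continuous (hproj hk) := by
  unfold hproj
  fun_prop

lemma continuous_wproj : Continuous (wproj m k) := by
  unfold wproj
  fun_prop

lemma bracket_hemb_hemb
    (hblock : ∀ s (i j : Fin m), (i : ℕ) < k → (j : ℕ) < k → b s i j = 0) (v w : Fin k → ℝ) :
    bracket b (hemb m k v) (hemb m k w) = 0 := by
  ext s
  simp only [bracket_apply, dotProduct, Matrix.mulVec, Finset.mul_sum, Pi.zero_apply]
  refine Finset.sum_eq_zero fun i _ => Finset.sum_eq_zero fun j _ => ?_
  rw [hemb_apply, hemb_apply]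
  split_ifs with hi hj hj
  · rw [hblock s i j hi hj]
    ring
  all_goals ring

lemma embH_gmul (hblock : ∀ s (i j : Fin m), (i : ℕ) < k → (j : ℕ) < k → b s i j = 0)
    (v w : Fin k → ℝ) : gmul b (embH m n k v) (embH m n k w) = embH m n k (v + w) := by
  simp [gmul_eq, embH_eq, bracket_hemb_hemb hblock]

/-- The point `i(A)·v` of `G`. -/
def glue (b : Fin n → Matrix (Fin m) (Fin m) ℝ) (p : W m n k × (Fin k → ℝ)) : G m n :=
  gmul b (embW m n k p.1) (embH m n k p.2)

/-- The right inverse of `(A, v) ↦ i(A)·v`. -/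
def unglue (hk : k ≤ m) (b : Fin n → Matrix (Fin m) (Fin m) ℝ) (Q : G m n) :
    W m n k × (Fin k → ℝ) :=
  ((wproj m k Q.1, Q.2 - (1 / 2 : ℝ) •
    bracket b (wemb m k (wproj m k Q.1)) (hemb m k (hproj hk Q.1))), hproj hk Q.1)

lemma continuous_embW : Continuous (embW m n k) := by
  simp only [funext embW_eq]
  fun_prop

lemma continuous_embH : Continuous (embH m n k) := by
  simp only [funext embH_eq]
  fun_prop

lemma continuous_glue : Continuous (glue b : W m n k × (Fin k → ℝ) → G m n) :=
  continuous_gmul.comp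
    ((continuous_embW.comp continuous_fst).prodMk (continuous_embH.comp continuous_snd))

lemma continuous_unglue (hk : k ≤ m) : Continuous (unglue hk b) := by
  have h1 := (continuous_wproj (m := m) (k := k)).comp (continuous_fst (X := Fin m → ℝ)
    (Y := Fin n → ℝ))
  have h2 := (continuous_hproj hk).comp (continuous_fst (X := Fin m → ℝ) (Y := Fin n → ℝ))
  simp only [Function.comp_def] at h1 h2
  unfold unglue
  fun_prop

lemma glue_unglue (hk : k ≤ m) (Q : G m n) : glue b (unglue hk b Q) = Q := by
  refine Prod.ext (wemb_wproj_add hk Q.1) ?_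
  simp [glue, unglue, gmul_eq, embH_eq, embW_eq]

lemma ginv_glue_gmul_glue (hskew : ∀ s, (b s).transpose = -(b s))
    (hblock : ∀ s (i j : Fin m), (i : ℕ) < k → (j : ℕ) < k → b s i j = 0)
    (A B : W m n k) (v w : Fin k → ℝ) :
    gmul b (ginv (glue b (A, v))) (glue b (B, w)) =
      gmul b (gmul b (gmul b (gmul b (ginv (embH m n k v)) (ginv (embW m n k A)))
        (embW m n k B)) (embH m n k v)) (hemb m k (w - v), 0) := by
  have h : ginv (glue b (A, v)) = gmul b (ginv (embH m n k v)) (ginv (embW m n k A)) := by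
    have h1 := bracket_swap hskew (hemb m k v) (wemb m k A.1)
    ext
    · simp [glue, ginv, gmul_eq, embH_eq, embW_eq]
    · simp [glue, ginv, gmul_eq, embH_eq, embW_eq, h1]
      ring
  have h2 := embH_gmul (n := n) hblock v (w - v)
  rw [add_sub_cancel] at h2
  rw [h, ← embH_eq, gmul_assoc _ (embH m n k v) (embH m n k (w - v)), h2, glue]
  simp only [gmul_assoc]

lemma ginv_glue_gmul_glue_same (hskew : ∀ s, (b s).transpose = -(b s))
    (hblock : ∀ s (i j : Fin m), (i : ℕ) < k → (j : ℕ) < k → b s i j = 0)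
    (A : W m n k) (v w : Fin k → ℝ) :
    gmul b (ginv (glue b (A, v))) (glue b (A, w)) = (hemb m k (w - v), 0) := by
  have h2 := embH_gmul (n := n) hblock v (w - v)
  rw [add_sub_cancel] at h2
  rw [← embH_eq]
  have : glue b (A, w) = gmul b (glue b (A, v)) (embH m n k (w - v)) := by
    rw [glue, glue, gmul_assoc, h2]
  rw [this, ginv_gmul_cancel hskew]

lemma exists_dW_lt (hskew : ∀ s, (b s).transpose = -(b s)) {A₀ : W m n k}
    {p : W m n k × W m n k → Prop} (hp : ∀ᶠ q in 𝓝 (A₀, A₀), p q) :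
    ∃ r > 0, ∀ A B, dW m n k b A₀ A < r → dW m n k b A B < r → p (A, B) := by
  let π : G m n → W m n k := fun Q => (wproj m k Q.1, Q.2)
  have hπ (A : W m n k) : π (embW m n k A) = A := by
    have := wproj_add 0 A.1
    rw [map_zero, add_zero] at this
    simp [π, embW_eq, this]
  have hπc : Continuous π := (continuous_wproj.comp continuous_fst).prodMk continuous_snd
  have hg : Continuous fun q : G m n × G m n => gmul b (embW m n k A₀) q.1 :=
    continuous_gmul.comp (continuous_const.prodMk continuous_fst)
  have hc : Continuous fun q : G m n × G m n => (π (gmul b (embW m n k A₀) q.1),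
      π (gmul b (gmul b (embW m n k A₀) q.1) q.2)) :=
    (hπc.comp hg).prodMk (hπc.comp (continuous_gmul.comp (hg.prodMk continuous_snd)))
  have ht := hc.tendsto (0, 0)
  simp only [gmul_zero, hπ] at ht
  have h := ht.eventually hp
  rw [nhds_prod_eq, eventually_prod_iff] at h
  obtain ⟨pa, hpa, pb, hpb, h⟩ := h
  obtain ⟨r, hr, hra⟩ := eventually_of_gauge_lt hpa
  obtain ⟨r', hr', hrb⟩ := eventually_of_gauge_lt hpb
  refine ⟨min r r', lt_min hr hr', fun A B hA hB => ?_⟩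
  have := h (hra _ ((gauge_le_qnorm _).trans_lt (hA.trans_le (min_le_left _ _))))
    (hrb _ ((gauge_le_qnorm _).trans_lt (hB.trans_le (min_le_right _ _))))
  simpa only [gmul_ginv_cancel hskew, hπ] using this

end Splitting

section ImplicitFunction

variable {m n k : ℕ} {b : Fin n → Matrix (Fin m) (Fin m) ℝ} {U : Set (G m n)}
  {f : G m n → Fin k → ℝ} {gradf : G m n → Matrix (Fin k) (Fin m) ℝ}

lemma jac_hemb (hkm : k ≤ m) (Q : G m n) (v : Fin k → ℝ) :
    jac (gradf Q) (hemb m k v) = (M1 m n k hkm gradf Q).mulVec v := by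
  ext j
  simp only [jac_apply, Matrix.mulVec, dotProduct, M1, Matrix.of_apply]
  symm
  refine Finset.sum_of_injOn (Fin.castLE hkm) (Fin.castLE_injective hkm).injOn
    (fun _ _ => Finset.mem_univ _) (fun i _ hi => ?_) fun i _ => ?_
  · rw [hemb_apply, dif_neg, mul_zero]
    intro h
    exact hi ⟨⟨i, h⟩, by simp, rfl⟩
  · simp [hemb_apply]

lemma exists_equiv_of_isUnit_M1 (hkm : k ≤ m) {P : G m n}
    (hM1 : IsUnit (M1 m n k hkm gradf P)) :
    ∃ e : (Fin k → ℝ) ≃L[ℝ] (Fin k → ℝ),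
      (e : (Fin k → ℝ) →L[ℝ] (Fin k → ℝ)) = (jac (gradf P)).comp (hemb m k) := by
  have hinj : Function.Injective
      ((jac (gradf P)).comp (hemb m k) : (Fin k → ℝ) →ₗ[ℝ] (Fin k → ℝ)) := by
    intro v w h
    refine Matrix.mulVec_injective_iff_isUnit.2 hM1 ?_
    simpa [jac_hemb hkm] using h
  exact ⟨(LinearEquiv.ofInjectiveEndo _ hinj).toContinuousLinearEquiv, rfl⟩

/-- A continuous parametrization of zeros of `f` is uniformly intrinsically differentiable. -/
lemma exists_uid (hskew : ∀ s, (b s).transpose = -(b s)) (hind : LinearIndependent ℝ b)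
    (hblock : ∀ s (i j : Fin m), (i : ℕ) < k → (j : ℕ) < k → b s i j = 0)
    (hU : IsOpen U) (hf : C1G m n k b U f gradf) {O : Set (W m n k)} (hO : IsOpen O)
    {φ : W m n k → Fin k → ℝ} (hφ : ContinuousOn φ O)
    (hzero : ∀ A ∈ O, f (glue b (A, φ A)) = 0) {A₀ : W m n k} (hA₀ : A₀ ∈ O)
    (hmem : glue b (A₀, φ A₀) ∈ U) (e : (Fin k → ℝ) ≃L[ℝ] (Fin k → ℝ))
    (he : (e : (Fin k → ℝ) →L[ℝ] (Fin k → ℝ)) =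
      (jac (gradf (glue b (A₀, φ A₀)))).comp (hemb m k)) :
    ∃ M, UID m n k b O φ A₀ M := by
  set Q₀ := glue b (A₀, φ A₀)
  let L : (Fin (m - k) → ℝ) →L[ℝ] (Fin k → ℝ) := (jac (gradf Q₀)).comp (wemb m k)
  let T : (Fin (m - k) → ℝ) →L[ℝ] (Fin k → ℝ) := (e.symm : (Fin k → ℝ) →L[ℝ] (Fin k → ℝ)).comp L
  refine ⟨LinearMap.toMatrix' (-T : (Fin (m - k) → ℝ) →L[ℝ] (Fin k → ℝ)).toLinearMap,
    fun ε hε => ?_⟩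
  obtain ⟨C, hC, hgauge⟩ := exists_gauge_gmul_le b
  set K := ‖(e.symm : (Fin k → ℝ) →L[ℝ] (Fin k → ℝ))‖
  have hK : 0 ≤ K := norm_nonneg _
  have hT : 0 ≤ ‖T‖ := norm_nonneg _
  obtain ⟨η, hη, hη1, hη2⟩ : ∃ η : ℝ, 0 < η ∧ η ≤ 1 / 2 ∧
      2 * (η * (1 + ‖T‖)) * (k + 1) ≤ ε := by
    refine ⟨min (1 / 2) (ε / (2 * (1 + ‖T‖) * (k + 1))), by positivity, min_le_left _ _, ?_⟩
    have := min_le_right (1 / 2) (ε / (2 * (1 + ‖T‖) * (k + 1)))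
    rw [le_div_iff₀ (by positivity)] at this
    linarith
  have hstrict := hf.eventually_strict hskew hind hU hmem
    (div_pos hη (by positivity : 0 < (K + 1) * C))
  have hc : ContinuousAt (fun A => glue b (A, φ A)) A₀ :=
    continuous_glue.continuousAt.comp
      (continuousAt_id.prodMk (hφ.continuousAt (hO.mem_nhds hA₀)))
  have hcc : Tendsto (fun q : W m n k × W m n k => (glue b (q.1, φ q.1), glue b (q.2, φ q.2)))
      (𝓝 (A₀, A₀)) (𝓝 (Q₀, Q₀)) := by
    exact (hc.tendsto.comp (continuous_fst.tendsto (A₀, A₀))).prodMk_nhds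
      (hc.tendsto.comp (continuous_snd.tendsto (A₀, A₀)))
  obtain ⟨r, hr, h⟩ := exists_dW_lt hskew (hcc.eventually hstrict)
  refine ⟨r, hr, fun A hA B hB hdA hdB _ => ?_⟩
  have h1 := h A B hdA hdB
  simp only [hzero A hA, hzero B hB, sub_zero, zero_sub, norm_neg] at h1
  set x := φ B - φ A with hx
  set a := B.1 - A.1 with ha
  set g := gmul b (gmul b (gmul b (ginv (embH m n k (φ A))) (ginv (embW m n k A)))
    (embW m n k B)) (embH m n k (φ A)) with hg
  have hdiff : (glue b (B, φ B)).1 - (glue b (A, φ A)).1 = hemb m k x + wemb m k a := by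
    simp only [glue, gmul_eq, embH_eq, embW_eq, hx, ha, map_sub]
    abel
  have hjac : jac (gradf Q₀) (hemb m k x + wemb m k a) = e (x + T a) := by
    have h2 : jac (gradf Q₀) (hemb m k x) = e x := (DFunLike.congr_fun he x).symm
    have h3 : e (T a) = jac (gradf Q₀) (wemb m k a) := e.apply_symm_apply _
    rw [map_add, map_add, h2, h3]
  rw [hdiff, hjac, ginv_glue_gmul_glue hskew hblock, ← hg, ← hx] at h1
  have hD : ‖x + T a‖ ≤ η * (gauge g + ‖x‖) := by
    have h2 : ‖x + T a‖ ≤ K * ‖e (x + T a)‖ := by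
      simpa using (e.symm : (Fin k → ℝ) →L[ℝ] (Fin k → ℝ)).le_opNorm (e (x + T a))
    have h3 := (hgauge g (hemb m k x)).trans
      (mul_le_mul_of_nonneg_left (add_le_add_right (norm_hemb_le x) (gauge g)) hC.le)
    have h4 : 0 ≤ gauge g + ‖x‖ := add_nonneg (gauge_nonneg g) (norm_nonneg x)
    calc ‖x + T a‖ ≤ K * (η / ((K + 1) * C) * (C * (gauge g + ‖x‖))) := by
          refine h2.trans (mul_le_mul_of_nonneg_left (h1.trans ?_) hK)
          gcongr
      _ = K / (K + 1) * (η * (gauge g + ‖x‖)) := by field_simp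
      _ ≤ 1 * (η * (gauge g + ‖x‖)) := by
          gcongr
          rw [div_le_one (by positivity)]
          linarith
      _ = η * (gauge g + ‖x‖) := one_mul _
  have hag : ‖a‖ ≤ gauge g := by
    have h2 : g.1 = wemb m k a := by
      simp only [hg, gmul_eq, embH_eq, embW_eq, ginv, ha, map_sub]
      abel
    have h3 := norm_le_norm_wemb a
    rw [← h2] at h3
    exact h3.trans (le_add_of_nonneg_right (Real.sqrt_nonneg _))
  have hxD : ‖x‖ ≤ ‖x + T a‖ + ‖T‖ * gauge g := by
    have h2 := norm_sub_le (x + T a) (T a)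
    rw [add_sub_cancel_right] at h2
    have h3 := T.le_opNorm a
    have h4 := mul_le_mul_of_nonneg_left hag hT
    linarith
  have hfin : ‖x + T a‖ ≤ 2 * (η * (1 + ‖T‖)) * gauge g := by
    nlinarith [mul_le_mul_of_nonneg_left hxD hη.le,
      mul_le_mul_of_nonneg_right hη1 (norm_nonneg (x + T a))]
  have hvec : (fun j => φ B j - φ A j - ∑ i,
      LinearMap.toMatrix' (-T : (Fin (m - k) → ℝ) →L[ℝ] (Fin k → ℝ)).toLinearMap j i *
        (B.1 i - A.1 i)) = x + T a := by
    have h2 : (LinearMap.toMatrix'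
        (-T : (Fin (m - k) → ℝ) →L[ℝ] (Fin k → ℝ)).toLinearMap).mulVec a = -T a := by
      rw [LinearMap.toMatrix'_mulVec]
      rfl
    ext j
    have h3 := congrFun h2 j
    simp only [Matrix.mulVec, dotProduct, ha, Pi.sub_apply, Pi.neg_apply] at h3
    simp only [h3, hx, ha, Pi.add_apply, Pi.sub_apply, sub_neg_eq_add]
  rw [hvec]
  calc enorm (x + T a) ≤ (k + 1) * ‖x + T a‖ := enorm_le _
    _ ≤ (k + 1) * (2 * (η * (1 + ‖T‖)) * gauge g) := by gcongr
    _ = 2 * (η * (1 + ‖T‖)) * (k + 1) * gauge g := by ring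
    _ ≤ ε * sigma m n k b φ A B :=
        mul_le_mul hη2 (gauge_le_qnorm g) (gauge_nonneg g) hε.le

end ImplicitFunction

/-- Implicit Function Theorem. If `f ∈ C¹_G(U,ℝ^k)`, `P ∈ U`,
`f(P) = 0` and the square horizontal block `M₁(P)` is invertible, then near `P` the
zero level set of `f` is the intrinsic graph of a map `φ : 𝒪 ⊂ W → ℝ^k` which is
uniformly intrinsically differentiable at every point of `𝒪`. -/
theorem statement16 (m n k : ℕ) (hm : 2 ≤ m) (hn : 1 ≤ n) (hk : 1 ≤ k) (hkm : k < m)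
    (b : Fin n → Matrix (Fin m) (Fin m) ℝ)
    (hskew : ∀ s, (b s).transpose = -(b s)) (hind : LinearIndependent ℝ b)
    (hblock : ∀ s (i j : Fin m), (i : ℕ) < k → (j : ℕ) < k → b s i j = 0)
    (U : Set (G m n)) (hU : IsOpen U)
    (f : G m n → Fin k → ℝ) (gradf : G m n → Matrix (Fin k) (Fin m) ℝ)
    (hf : C1G m n k b U f gradf)
    (P : G m n) (hP : P ∈ U) (hfP : f P = 0)
    (hM1 : IsUnit (M1 m n k hkm.le gradf P)) :
    ∃ O : Set (W m n k), IsOpen O ∧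
      ∃ φ : W m n k → Fin k → ℝ,
        (∀ A ∈ O, ∃ M, UID m n k b O φ A M) ∧
        ∃ U' : Set (G m n), IsOpen U' ∧ U' ⊆ U ∧ P ∈ U' ∧
          {Q | Q ∈ U' ∧ f Q = 0} = graphMap m n k b φ '' O ∩ U' := by
  have hinv : ∀ᶠ Q in 𝓝 P, ∃ e : (Fin k → ℝ) ≃L[ℝ] (Fin k → ℝ),
      (e : (Fin k → ℝ) →L[ℝ] (Fin k → ℝ)) = (jac (gradf Q)).comp (hemb m k) := by
    obtain ⟨e, he⟩ := exists_equiv_of_isUnit_M1 hkm.le hM1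
    have hc : ContinuousAt (fun Q => (jac (gradf Q)).comp (hemb m k)) P :=
      ((ContinuousLinearMap.precomp (Fin k → ℝ) (hemb m k)).comp jac).continuous.continuousAt.comp
        (hf.2.1.continuousAt (hU.mem_nhds hP))
    have := e.nhds
    rw [he] at this
    exact hc.eventually this
  obtain ⟨N, hN, hNo, hPN⟩ := eventually_nhds_iff.1 ((hU.eventually_mem hP).and hinv)
  obtain ⟨e, he⟩ := (hN P hPN).2
  have heP : glue b ((unglue hkm.le b P).1, (unglue hkm.le b P).2) = P := glue_unglue hkm.le P
  have hstrict : ∀ ε > 0, ∀ᶠ p : W m n k × (Fin k → ℝ) × (Fin k → ℝ) in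
      𝓝 ((unglue hkm.le b P).1, (unglue hkm.le b P).2, (unglue hkm.le b P).2),
      ‖f (glue b (p.1, p.2.1)) - f (glue b (p.1, p.2.2)) - e (p.2.1 - p.2.2)‖ ≤
        ε * ‖p.2.1 - p.2.2‖ := by
    intro ε hε
    have hc : Continuous fun p : W m n k × (Fin k → ℝ) × (Fin k → ℝ) =>
        (glue b (p.1, p.2.2), glue b (p.1, p.2.1)) :=
      (continuous_glue.comp (by fun_prop)).prodMk (continuous_glue.comp (by fun_prop))
    have ht := hc.tendsto
      ((unglue hkm.le b P).1, (unglue hkm.le b P).2, (unglue hkm.le b P).2)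
    simp only [heP] at ht
    filter_upwards [ht.eventually (hf.eventually_strict hskew hind hU hP hε)] with ⟨A, v, w⟩ h
    have hdiff : (glue b (A, v)).1 - (glue b (A, w)).1 = hemb m k (v - w) := by
      simp [glue, gmul_eq, embH_eq]
    have hjac : jac (gradf P) (hemb m k (v - w)) = e (v - w) :=
      (DFunLike.congr_fun he (v - w)).symm
    rw [ginv_glue_gmul_glue_same hskew hblock, hdiff, hjac] at h
    refine h.trans (mul_le_mul_of_nonneg_left ?_ hε.le)
    simpa [gauge] using norm_hemb_le (m := m) (v - w)
  obtain ⟨O, hO, hPO, δ, hδ, φ, hV, hφc, hφ⟩ := exists_implicit_function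
    (F := fun A v => f (glue b (A, v))) e (by rw [heP, hfP])
    (hNo.preimage continuous_glue) (by rw [mem_preimage, heP]; exact hPN)
    (hf.1.comp continuous_glue.continuousOn fun p hp => (hN _ hp).1) hstrict
  have hzero : ∀ A ∈ O, f (glue b (A, φ A)) = 0 := fun A hA =>
    ((hφ A hA).2 _ (hφ A hA).1).2 rfl
  refine ⟨O, hO, φ, fun A hA => ?_, unglue hkm.le b ⁻¹' O ×ˢ Metric.ball _ δ,
    (hO.prod Metric.isOpen_ball).preimage (continuous_unglue hkm.le), fun Q hQ => ?_,
    ⟨hPO, Metric.mem_ball_self hδ⟩, ?_⟩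
  · have hmem := hN _ (hV A hA _ (hφ A hA).1)
    obtain ⟨e', he'⟩ := hmem.2
    exact exists_uid hskew hind hblock hU hf hO hφc hzero hA hmem.1 e' he'
  · have := hV _ hQ.1 _ hQ.2
    rw [mem_preimage, Prod.mk.eta, glue_unglue] at this
    exact (hN Q this).1
  · ext Q
    constructor
    · rintro ⟨hQ, hQ0⟩
      have h := (hφ _ hQ.1).2 _ hQ.2
      rw [Prod.mk.eta, glue_unglue] at h
      refine ⟨⟨(unglue hkm.le b Q).1, hQ.1, ?_⟩, hQ⟩
      change glue b ((unglue hkm.le b Q).1, φ (unglue hkm.le b Q).1) = Q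
      rw [← h.1 hQ0, Prod.mk.eta, glue_unglue]
    · rintro ⟨⟨A, hA, rfl⟩, hQ⟩
      exact ⟨hQ, hzero A hA⟩

end Carnot
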